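/- Fix ν ∈ ℝ and let Q be an admissible quantization of P¹ of type (i)′ with parameter ν. Then for every integer N ≥ 1, Q(cos Nθ) equals multiplication by cos Nθ and Q(sin Nθ) equals multiplication by sin Nθ (equivalently, the complex-linear extension of Q sends e^{iNθ} to multiplication by e^{iNθ} for every integer N). -/

import Mathlib

noncomputable section

open Complex

/-- Partial derivative in the first (angle) variable. -/
def pdTheta (f : ℝ × ℝ → ℝ) : ℝ × ℝ → ℝ := fun p => deriv (fun t => f (t, p.2)) p.1

/-- Partial derivative in the second (momentum) variable. -/
def pdEll (f : ℝ × ℝ → ℝ) : ℝ × ℝ → ℝ := fun p => deriv (fun l => f (p.1, l)) p.2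

/-- Poisson bracket `{f,g} = f_ℓ g_θ − f_θ g_ℓ`. -/
def pb (f g : ℝ × ℝ → ℝ) : ℝ × ℝ → ℝ :=
  fun p => pdEll f p * pdTheta g p - pdTheta f p * pdEll g p

/-- Spanning set for the polynomial algebra `P`. -/
def PGens : Set (ℝ × ℝ → ℝ) :=
  {h | ∃ r m : ℕ, h = (fun p : ℝ × ℝ => p.2 ^ r * Real.sin (m * p.1)) ∨
       h = (fun p : ℝ × ℝ => p.2 ^ r * Real.cos (m * p.1))}

/-- The polynomial algebra `P`. -/
def P : Submodule ℝ (ℝ × ℝ → ℝ) := Submodule.span ℝ PGens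

def fone : ℝ × ℝ → ℝ := fun _ => 1
def fell : ℝ × ℝ → ℝ := fun p => p.2
def fsin : ℝ × ℝ → ℝ := fun p => Real.sin p.1
def fcos : ℝ × ℝ → ℝ := fun p => Real.cos p.1

lemma fone_mem_P : fone ∈ P :=
  Submodule.subset_span ⟨0, 0, Or.inr (by funext p; simp [fone])⟩

lemma fell_mem_P : fell ∈ P :=
  Submodule.subset_span ⟨1, 0, Or.inr (by funext p; simp [fell])⟩

lemma fsin_mem_P : fsin ∈ P :=
  Submodule.subset_span ⟨0, 1, Or.inl (by funext p; simp [fsin])⟩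

lemma fcos_mem_P : fcos ∈ P :=
  Submodule.subset_span ⟨0, 1, Or.inr (by funext p; simp [fcos])⟩

/-- The domain `D = C^∞(S¹,ℂ)`: smooth `2π`-periodic functions. -/
def Dom : Submodule ℂ (ℝ → ℂ) where
  carrier := {ψ | ContDiff ℝ (⊤ : ℕ∞) ψ ∧ ∀ t, ψ (t + 2 * Real.pi) = ψ t}
  add_mem' := by
    intro a b ha hb
    exact ⟨ha.1.add hb.1, fun t => by simp [Pi.add_apply, ha.2 t, hb.2 t]⟩
  zero_mem' := ⟨contDiff_const, fun t => rfl⟩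
  smul_mem' := by
    intro c a ha
    exact ⟨ha.1.const_smul c, fun t => by simp [Pi.smul_apply, ha.2 t]⟩

/-- The `L²` inner product on `D`. -/
def ip (φ ψ : ℝ → ℂ) : ℂ := ∫ t in (0:ℝ)..(2 * Real.pi), (starRingEnd ℂ) (φ t) * ψ t

/-- Symmetric operator on `D`. -/
def SymmetricOp (A : Dom →ₗ[ℂ] Dom) : Prop :=
  ∀ φ ψ : Dom, ip (A φ : ℝ → ℂ) (ψ : ℝ → ℂ) = ip (φ : ℝ → ℂ) (A ψ : ℝ → ℂ)

/-- An admissible quantization of type (i)′ with parameter ν of a Lie subalgebra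
`O ⊆ P` containing the basic set. -/
structure IsQuant (O : Submodule ℝ (ℝ × ℝ → ℝ)) (ν : ℝ)
    (Q : O →ₗ[ℝ] (Dom →ₗ[ℂ] Dom)) : Prop where
  map_bracket : ∀ (f g : O) (h : pb f g ∈ O),
    Q ⟨pb f g, h⟩ = Complex.I • (Q f ∘ₗ Q g - Q g ∘ₗ Q f)
  map_one : ∀ h : fone ∈ O, Q ⟨fone, h⟩ = LinearMap.id
  symm : ∀ f : O, SymmetricOp (Q f)
  map_ell : ∀ (h : fell ∈ O) (ψ : Dom) (t : ℝ),
    (Q ⟨fell, h⟩ ψ : ℝ → ℂ) t = -Complex.I * deriv (ψ : ℝ → ℂ) t + (ν : ℂ) * (ψ : ℝ → ℂ) t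
  map_sin : ∀ (h : fsin ∈ O) (ψ : Dom) (t : ℝ),
    (Q ⟨fsin, h⟩ ψ : ℝ → ℂ) t = (Real.sin t : ℂ) * (ψ : ℝ → ℂ) t
  map_cos : ∀ (h : fcos ∈ O) (ψ : Dom) (t : ℝ),
    (Q ⟨fcos, h⟩ ψ : ℝ → ℂ) t = (Real.cos t : ℂ) * (ψ : ℝ → ℂ) t

end
noncomputable section
/-- Spanning set of real trigonometric polynomials. -/
def TrigGens : Set (ℝ → ℝ) :=
  {h | ∃ m : ℕ, h = (fun t => Real.sin (m * t)) ∨ h = fun t => Real.cos (m * t)}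

/-- Real trigonometric polynomials. -/
def Trig : Submodule ℝ (ℝ → ℝ) := Submodule.span ℝ TrigGens

/-- Spanning set for `P¹`, the elements of `P` of degree at most 1 in `ℓ`. -/
def P1Gens : Set (ℝ × ℝ → ℝ) :=
  {h | ∃ r m : ℕ, r ≤ 1 ∧
        (h = (fun p : ℝ × ℝ => p.2 ^ r * Real.sin (m * p.1)) ∨
         h = (fun p : ℝ × ℝ => p.2 ^ r * Real.cos (m * p.1)))}

/-- `P¹ ⊆ P`: polynomials affine in the momentum `ℓ`. -/
def P1 : Submodule ℝ (ℝ × ℝ → ℝ) := Submodule.span ℝ P1Gens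

lemma fone_mem_P1 : fone ∈ P1 :=
  Submodule.subset_span ⟨0, 0, Nat.zero_le 1, Or.inr (by funext p; simp [fone])⟩
lemma fell_mem_P1 : fell ∈ P1 :=
  Submodule.subset_span ⟨1, 0, le_refl 1, Or.inr (by funext p; simp [fell])⟩
lemma fsin_mem_P1 : fsin ∈ P1 :=
  Submodule.subset_span ⟨0, 1, Nat.zero_le 1, Or.inl (by funext p; simp [fsin])⟩
lemma fcos_mem_P1 : fcos ∈ P1 :=
  Submodule.subset_span ⟨0, 1, Nat.zero_le 1, Or.inr (by funext p; simp [fcos])⟩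
end
noncomputable section
lemma sinN_mem_P1 (N : ℕ) : (fun p : ℝ × ℝ => Real.sin (N * p.1)) ∈ P1 :=
  Submodule.subset_span ⟨0, N, Nat.zero_le 1, Or.inl (by funext p; simp)⟩
lemma cosN_mem_P1 (N : ℕ) : (fun p : ℝ × ℝ => Real.cos (N * p.1)) ∈ P1 :=
  Submodule.subset_span ⟨0, N, Nat.zero_le 1, Or.inr (by funext p; simp)⟩

abbrev EndD := Module.End ℂ Dom

def qC (Q : P1 →ₗ[ℝ] (Dom →ₗ[ℂ] Dom)) (m : ℕ) : EndD :=
  Q ⟨fun p : ℝ × ℝ => Real.cos (m * p.1), cosN_mem_P1 m⟩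
def qS (Q : P1 →ₗ[ℝ] (Dom →ₗ[ℂ] Dom)) (m : ℕ) : EndD :=
  Q ⟨fun p : ℝ × ℝ => Real.sin (m * p.1), sinN_mem_P1 m⟩

lemma lcos_mem : (fun p : ℝ × ℝ => p.2 * Real.cos p.1) ∈ P1 :=
  Submodule.subset_span ⟨1, 1, le_refl 1, Or.inr (by funext p; simp)⟩
lemma lsin_mem : (fun p : ℝ × ℝ => p.2 * Real.sin p.1) ∈ P1 :=
  Submodule.subset_span ⟨1, 1, le_refl 1, Or.inl (by funext p; simp)⟩

def qA (Q : P1 →ₗ[ℝ] (Dom →ₗ[ℂ] Dom)) : EndD := Q ⟨_, lcos_mem⟩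
def qB (Q : P1 →ₗ[ℝ] (Dom →ₗ[ℂ] Dom)) : EndD := Q ⟨_, lsin_mem⟩

lemma real_smul_end (c : ℝ) (T : EndD) : c • T = (c : ℂ) • T := by
  ext x t
  simp

lemma brk {ν : ℝ} {Q : P1 →ₗ[ℝ] (Dom →ₗ[ℂ] Dom)} (hQ : IsQuant P1 ν Q) (f g h : P1)
    (e : pb f g = h) : (Q h : EndD) = Complex.I • ((Q f : EndD) * Q g - (Q g : EndD) * Q f) := by
  have hm : pb f g ∈ P1 := by rw [e]; exact h.2
  have := hQ.map_bracket f g hm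
  have e2 : (⟨pb f g, hm⟩ : P1) = h := Subtype.ext e
  rw [e2] at this
  exact this

lemma d_cos (m x : ℝ) : deriv (fun t : ℝ => Real.cos (m * t)) x = -(m * Real.sin (m * x)) := by
  have := ((hasDerivAt_id x).const_mul m).cos
  simpa [mul_comm] using this.deriv
lemma d_sin (m x : ℝ) : deriv (fun t : ℝ => Real.sin (m * t)) x = (m * Real.cos (m * x)) := by
  have := ((hasDerivAt_id x).const_mul m).sin
  simpa [mul_comm] using this.deriv

lemma pb_lin (a b : ℝ → ℝ) (p : ℝ × ℝ) :
    pb (fun p => p.2 * a p.1) (fun p => b p.1) p = a p.1 * deriv b p.1 := by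
  simp [pb, pdEll, pdTheta]

section

lemma trig1 (k : ℕ) (x : ℝ) : Real.sin (((k + 2 : ℕ) : ℝ) * x) =
    Real.sin (((k + 1 : ℕ) : ℝ) * x) * Real.cos x + Real.cos (((k + 1 : ℕ) : ℝ) * x) * Real.sin x := by
  rw [← Real.sin_add]; push_cast; ring_nf
lemma trig2 (k : ℕ) (x : ℝ) : Real.cos (((k + 2 : ℕ) : ℝ) * x) =
    Real.cos (((k + 1 : ℕ) : ℝ) * x) * Real.cos x - Real.sin (((k + 1 : ℕ) : ℝ) * x) * Real.sin x := by
  rw [← Real.cos_add]; push_cast; ring_nf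
lemma trig3 (k : ℕ) (x : ℝ) : Real.sin ((k : ℝ) * x) =
    Real.sin (((k + 1 : ℕ) : ℝ) * x) * Real.cos x - Real.cos (((k + 1 : ℕ) : ℝ) * x) * Real.sin x := by
  rw [← Real.sin_sub]; push_cast; ring_nf
lemma trig4 (k : ℕ) (x : ℝ) : Real.cos ((k : ℝ) * x) =
    Real.cos (((k + 1 : ℕ) : ℝ) * x) * Real.cos x + Real.sin (((k + 1 : ℕ) : ℝ) * x) * Real.sin x := by
  rw [← Real.cos_sub]; push_cast; ring_nf

lemma b1 {ν : ℝ} {Q : P1 →ₗ[ℝ] (Dom →ₗ[ℂ] Dom)} (hQ : IsQuant P1 ν Q) (k : ℕ) : Complex.I • (qA Q * qC Q (k+1) - qC Q (k+1) * qA Q) =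
    (-(((k:ℂ) + 1) / 2)) • (qS Q (k+2) + qS Q k) := by
  have := brk hQ ⟨_, lcos_mem⟩ ⟨_, cosN_mem_P1 (k+1)⟩
    ((-(((k:ℝ) + 1) / 2)) • (⟨_, sinN_mem_P1 (k+2)⟩ + ⟨_, sinN_mem_P1 k⟩)) (by
      funext p
      refine (pb_lin (fun t => Real.cos t) (fun t => Real.cos (((k+1 : ℕ) : ℝ) * t)) p).trans ?_
      simp only [d_cos, Submodule.coe_smul, Submodule.coe_add, Pi.smul_apply, Pi.add_apply,
        smul_eq_mul]
      rw [trig1 k p.1, trig3 k p.1]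
      push_cast; ring)
  rw [map_smul, map_add] at this
  refine this.symm.trans ((real_smul_end _ _).trans ?_)
  refine congrArg₂ (· • ·) ?_ rfl
  push_cast; rfl

lemma b2 {ν : ℝ} {Q : P1 →ₗ[ℝ] (Dom →ₗ[ℂ] Dom)} (hQ : IsQuant P1 ν Q) (k : ℕ) : Complex.I • (qA Q * qS Q (k+1) - qS Q (k+1) * qA Q) =
    ((((k:ℂ) + 1) / 2)) • (qC Q (k+2) + qC Q k) := by
  have := brk hQ ⟨_, lcos_mem⟩ ⟨_, sinN_mem_P1 (k+1)⟩
    (((((k:ℝ) + 1) / 2)) • (⟨_, cosN_mem_P1 (k+2)⟩ + ⟨_, cosN_mem_P1 k⟩)) (by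
      funext p
      refine (pb_lin (fun t => Real.cos t) (fun t => Real.sin (((k+1 : ℕ) : ℝ) * t)) p).trans ?_
      simp only [d_sin, Submodule.coe_smul, Submodule.coe_add, Pi.smul_apply, Pi.add_apply,
        smul_eq_mul]
      rw [trig2 k p.1, trig4 k p.1]
      push_cast; ring)
  rw [map_smul, map_add] at this
  refine this.symm.trans ((real_smul_end _ _).trans ?_)
  refine congrArg₂ (· • ·) ?_ rfl
  push_cast; rfl

lemma b3 {ν : ℝ} {Q : P1 →ₗ[ℝ] (Dom →ₗ[ℂ] Dom)} (hQ : IsQuant P1 ν Q) (k : ℕ) : Complex.I • (qB Q * qC Q (k+1) - qC Q (k+1) * qB Q) =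
    ((((k:ℂ) + 1) / 2)) • (qC Q (k+2) - qC Q k) := by
  have := brk hQ ⟨_, lsin_mem⟩ ⟨_, cosN_mem_P1 (k+1)⟩
    (((((k:ℝ) + 1) / 2)) • (⟨_, cosN_mem_P1 (k+2)⟩ - ⟨_, cosN_mem_P1 k⟩)) (by
      funext p
      refine (pb_lin (fun t => Real.sin t) (fun t => Real.cos (((k+1 : ℕ) : ℝ) * t)) p).trans ?_
      simp only [d_cos, Submodule.coe_smul, Submodule.coe_sub, Pi.smul_apply, Pi.sub_apply,
        smul_eq_mul]
      rw [trig2 k p.1, trig4 k p.1]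
      push_cast; ring)
  rw [map_smul, map_sub] at this
  refine this.symm.trans ((real_smul_end _ _).trans ?_)
  refine congrArg₂ (· • ·) ?_ rfl
  push_cast; rfl

lemma b4 {ν : ℝ} {Q : P1 →ₗ[ℝ] (Dom →ₗ[ℂ] Dom)} (hQ : IsQuant P1 ν Q) (k : ℕ) : Complex.I • (qB Q * qS Q (k+1) - qS Q (k+1) * qB Q) =
    ((((k:ℂ) + 1) / 2)) • (qS Q (k+2) - qS Q k) := by
  have := brk hQ ⟨_, lsin_mem⟩ ⟨_, sinN_mem_P1 (k+1)⟩
    (((((k:ℝ) + 1) / 2)) • (⟨_, sinN_mem_P1 (k+2)⟩ - ⟨_, sinN_mem_P1 k⟩)) (by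
      funext p
      refine (pb_lin (fun t => Real.sin t) (fun t => Real.sin (((k+1 : ℕ) : ℝ) * t)) p).trans ?_
      simp only [d_sin, Submodule.coe_smul, Submodule.coe_sub, Pi.smul_apply, Pi.sub_apply,
        smul_eq_mul]
      rw [trig1 k p.1, trig3 k p.1]
      push_cast; ring)
  rw [map_smul, map_sub] at this
  refine this.symm.trans ((real_smul_end _ _).trans ?_)
  refine congrArg₂ (· • ·) ?_ rfl
  push_cast; rfl

lemma c0 {ν : ℝ} {Q : P1 →ₗ[ℝ] (Dom →ₗ[ℂ] Dom)} (hQ : IsQuant P1 ν Q) : qC Q 0 = 1 := by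
  have := hQ.map_one fone_mem_P1
  refine Eq.trans ?_ this
  unfold qC
  congr 2
  funext p; simp [fone]

lemma s0 {Q : P1 →ₗ[ℝ] (Dom →ₗ[ℂ] Dom)} : qS Q 0 = 0 := by
  have : (⟨fun p : ℝ × ℝ => Real.sin ((0:ℕ) * p.1), sinN_mem_P1 0⟩ : P1) = 0 := by
    apply Subtype.ext; funext p; simp
  unfold qS
  rw [this, map_zero]

lemma c1 {ν : ℝ} {Q : P1 →ₗ[ℝ] (Dom →ₗ[ℂ] Dom)} (hQ : IsQuant P1 ν Q) (ψ : Dom) (t : ℝ) : (qC Q 1 ψ : ℝ → ℂ) t = (Real.cos t : ℂ) * (ψ : ℝ → ℂ) t := by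
  rw [← hQ.map_cos fcos_mem_P1]
  have e : (⟨_, cosN_mem_P1 1⟩ : P1) = ⟨fcos, fcos_mem_P1⟩ := by
    apply Subtype.ext; funext p; simp [fcos]
  unfold qC
  rw [e]

lemma s1 {ν : ℝ} {Q : P1 →ₗ[ℝ] (Dom →ₗ[ℂ] Dom)} (hQ : IsQuant P1 ν Q) (ψ : Dom) (t : ℝ) : (qS Q 1 ψ : ℝ → ℂ) t = (Real.sin t : ℂ) * (ψ : ℝ → ℂ) t := by
  rw [← hQ.map_sin fsin_mem_P1]
  have e : (⟨_, sinN_mem_P1 1⟩ : P1) = ⟨fsin, fsin_mem_P1⟩ := by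
    apply Subtype.ext; funext p; simp [fsin]
  unfold qS
  rw [e]

lemma brLE {ν : ℝ} {Q : P1 →ₗ[ℝ] (Dom →ₗ[ℂ] Dom)} (hQ : IsQuant P1 ν Q) (k : ℕ) (j : ℂ) (hj : j * j = -1) :
    Complex.I • ((qA Q + j • qB Q) * (qC Q (k+1) + j • qS Q (k+1))
      - (qC Q (k+1) + j • qS Q (k+1)) * (qA Q + j • qB Q)) =
    (j * ((k:ℂ)+1)) • (qC Q (k+2) + j • qS Q (k+2)) := by
  have h1 := b1 hQ k
  have h2 := b2 hQ k
  have h3 := b3 hQ k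
  have h4 := b4 hQ k
  have e : Complex.I • ((qA Q + j • qB Q) * (qC Q (k+1) + j • qS Q (k+1))
      - (qC Q (k+1) + j • qS Q (k+1)) * (qA Q + j • qB Q)) =
      Complex.I • (qA Q * qC Q (k+1) - qC Q (k+1) * qA Q)
      + j • (Complex.I • (qA Q * qS Q (k+1) - qS Q (k+1) * qA Q))
      + j • (Complex.I • (qB Q * qC Q (k+1) - qC Q (k+1) * qB Q))
      + (j * j) • (Complex.I • (qB Q * qS Q (k+1) - qS Q (k+1) * qB Q)) := by
    simp only [mul_add, add_mul, smul_mul_assoc, mul_smul_comm]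
    module
  rw [e, h1, h2, h3, h4, smul_add (j * ((k:ℂ)+1)), smul_smul _ j,
    show j * ((k:ℂ)+1) * j = -((k:ℂ)+1) by linear_combination ((k:ℂ)+1) * hj, hj]
  module

lemma LF {ν : ℝ} {Q : P1 →ₗ[ℝ] (Dom →ₗ[ℂ] Dom)} (hQ : IsQuant P1 ν Q) (j : ℂ) (hj : j * j = -1) :
    Complex.I • ((qA Q + j • qB Q) * (qC Q 1 + (-j) • qS Q 1)
      - (qC Q 1 + (-j) • qS Q 1) * (qA Q + j • qB Q)) = (-j) • (1 : EndD) := by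
  have h1 := b1 hQ 0
  have h2 := b2 hQ 0
  have h3 := b3 hQ 0
  have h4 := b4 hQ 0
  simp only [zero_add, c0 hQ, s0] at h1 h2 h3 h4
  have e : Complex.I • ((qA Q + j • qB Q) * (qC Q 1 + (-j) • qS Q 1)
      - (qC Q 1 + (-j) • qS Q 1) * (qA Q + j • qB Q)) =
      Complex.I • (qA Q * qC Q 1 - qC Q 1 * qA Q)
      - j • (Complex.I • (qA Q * qS Q 1 - qS Q 1 * qA Q))
      + j • (Complex.I • (qB Q * qC Q 1 - qC Q 1 * qB Q))
      - (j * j) • (Complex.I • (qB Q * qS Q 1 - qS Q 1 * qB Q)) := by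
    simp only [mul_add, add_mul, smul_mul_assoc, mul_smul_comm]
    module
  rw [e, h1, h2, h3, h4, hj]
  push_cast
  module

lemma MF {ν : ℝ} {Q : P1 →ₗ[ℝ] (Dom →ₗ[ℂ] Dom)} (hQ : IsQuant P1 ν Q) (j : ℂ) (hj : j * j = -1) :
    (qC Q 1 + j • qS Q 1) * (qC Q 1 + (-j) • qS Q 1) = 1 ∧
    (qC Q 1 + (-j) • qS Q 1) * (qC Q 1 + j • qS Q 1) = 1 := by
  constructor <;>
  · refine LinearMap.ext fun ψ => Subtype.ext (funext fun t => ?_)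
    have h : (Real.cos t : ℂ) ^ 2 + (Real.sin t : ℂ) ^ 2 = 1 := by
      exact_mod_cast Real.cos_sq_add_sin_sq t
    simp only [Module.End.mul_apply, LinearMap.add_apply, LinearMap.smul_apply,
      Submodule.coe_add, Submodule.coe_smul, Pi.add_apply,
      Pi.smul_apply, smul_eq_mul, c1 hQ, s1 hQ, Module.End.one_apply]
    linear_combination (ψ : ℝ → ℂ) t * h - (Real.sin t : ℂ)^2 * (ψ : ℝ → ℂ) t * hj

lemma abstract_pow_aux {R : Type*} [Ring R] [Algebra ℂ R] (j : ℂ) (hj0 : j ≠ 0) (L M F : R) (E : ℕ → R)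
    (hE1 : E 0 = M) (m1 : M * F = 1) (m2 : F * M = 1)
    (lf : Complex.I • (L * F - F * L) = (-j) • (1 : R))
    (hE : ∀ k : ℕ, Complex.I • (L * E k - E k * L) = (j * ((k:ℂ)+1)) • E (k+1)) (k : ℕ) :
    E k = M ^ (k+1) := by
  have base : Complex.I • (L * M - M * L) = j • (M * M) := by
    have : M * (Complex.I • (L * F - F * L)) * M = M * ((-j) • (1 : R)) * M := by rw [lf]
    have e : M * (L * F - F * L) * M = M * L - L * M := by
      calc M * (L * F - F * L) * M = M * L * (F * M) - (M * F) * L * M := by noncomm_ring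
        _ = _ := by rw [m1, m2, mul_one, one_mul]
    rw [mul_smul_comm, smul_mul_assoc, e, mul_smul_comm, smul_mul_assoc, mul_one] at this
    linear_combination (norm := module) (-1 : ℂ) • this
  have pw : ∀ n : ℕ, Complex.I • (L * M ^ n - M ^ n * L) = (j * n) • M ^ (n+1) := by
    intro n
    induction n with
    | zero => simp
    | succ n ih =>
      have e : Complex.I • (L * M ^ (n+1) - M ^ (n+1) * L) =
        (Complex.I • (L * M ^ n - M ^ n * L)) * M + M ^ n * (Complex.I • (L * M - M * L)) := by
        rw [smul_mul_assoc, mul_smul_comm, ← smul_add, pow_succ]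
        congr 1
        noncomm_ring
      rw [e, ih, base, smul_mul_assoc, mul_smul_comm, ← mul_assoc]
      simp only [← pow_succ]
      push_cast
      module
  induction k with
  | zero => simp [hE1]
  | succ k ih =>
    have h := hE k
    rw [ih, pw] at h
    have hk : j * ((k:ℂ)+1) ≠ 0 := mul_ne_zero hj0 (by exact_mod_cast Nat.succ_ne_zero k)
    push_cast at h
    have h2 := congrArg (fun x => (j * ((k:ℂ)+1))⁻¹ • x) h
    simp only [smul_smul, inv_mul_cancel₀ hk, one_smul] at h2
    exact h2.symm

lemma Epow {ν : ℝ} {Q : P1 →ₗ[ℝ] (Dom →ₗ[ℂ] Dom)} (hQ : IsQuant P1 ν Q) (k : ℕ)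
    (j : ℂ) (hj : j * j = -1) :
    qC Q (k+1) + j • qS Q (k+1) = (qC Q 1 + j • qS Q 1) ^ (k+1) := by
  obtain ⟨m1, m2⟩ := MF hQ j hj
  have hj0 : j ≠ 0 := by rintro rfl; simp at hj
  exact abstract_pow_aux j hj0 (qA Q + j • qB Q) _ _ (fun k => qC Q (k+1) + j • qS Q (k+1)) rfl m1 m2
    (LF hQ j hj) (fun k => brLE hQ k j hj) k

lemma Mpow {ν : ℝ} {Q : P1 →ₗ[ℝ] (Dom →ₗ[ℂ] Dom)} (hQ : IsQuant P1 ν Q) (j : ℂ) (n : ℕ) (ψ : Dom) (t : ℝ) :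
    (((qC Q 1 + j • qS Q 1) ^ n) ψ : ℝ → ℂ) t
      = ((Real.cos t : ℂ) + j * Real.sin t) ^ n * (ψ : ℝ → ℂ) t := by
  induction n with
  | zero => simp
  | succ n ih =>
    rw [pow_succ', Module.End.mul_apply]
    simp only [LinearMap.add_apply, LinearMap.smul_apply,
      Submodule.coe_add, Submodule.coe_smul, Pi.add_apply,
      Pi.smul_apply, smul_eq_mul, c1 hQ, s1 hQ, ih]
    ring

lemma deM (j : ℂ) (hj : j * j = -1) (n : ℕ) (t : ℝ) :
    ((Real.cos t : ℂ) + j * Real.sin t) ^ n = (Real.cos (n * t) : ℂ) + j * Real.sin (n * t) := by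
  induction n with
  | zero => simp
  | succ n ih =>
    rw [pow_succ, ih]
    push_cast
    rw [show ((n:ℂ)+1) * t = n * t + t by ring, Complex.cos_add, Complex.sin_add]
    linear_combination (Complex.sin (n*t) * Complex.sin t) * hj

lemma Efin {ν : ℝ} {Q : P1 →ₗ[ℝ] (Dom →ₗ[ℂ] Dom)} (hQ : IsQuant P1 ν Q) (k : ℕ) (j : ℂ) (hj : j * j = -1) (ψ : Dom) (t : ℝ) :
    (qC Q (k+1) ψ : ℝ → ℂ) t + j * (qS Q (k+1) ψ : ℝ → ℂ) t =
     ((Real.cos ((k+1:ℕ) * t) : ℂ) + j * Real.sin ((k+1:ℕ) * t)) * (ψ : ℝ → ℂ) t := by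
  rw [← deM j hj, ← Mpow hQ, ← Epow hQ k j hj]
  simp
end

/-- Any admissible quantization of `P¹` of type (i)′ sends `cos Nθ` and `sin Nθ` to the
corresponding multiplication operators, for every `N ≥ 1`. -/
theorem stmt18 (ν : ℝ) (Q : P1 →ₗ[ℝ] (Dom →ₗ[ℂ] Dom)) (hQ : IsQuant P1 ν Q)
    (N : ℕ) (hN : 1 ≤ N) :
    (∀ (ψ : Dom) (t : ℝ),
      (Q ⟨fun p : ℝ × ℝ => Real.cos (N * p.1), cosN_mem_P1 N⟩ ψ : ℝ → ℂ) t =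
        (Real.cos (N * t) : ℂ) * (ψ : ℝ → ℂ) t) ∧
    ∀ (ψ : Dom) (t : ℝ),
      (Q ⟨fun p : ℝ × ℝ => Real.sin (N * p.1), sinN_mem_P1 N⟩ ψ : ℝ → ℂ) t =
        (Real.sin (N * t) : ℂ) * (ψ : ℝ → ℂ) t := by
  obtain ⟨k, rfl⟩ : ∃ k, N = k + 1 := ⟨N - 1, by omega⟩
  have h1 := Efin hQ k Complex.I Complex.I_mul_I
  have h2 := Efin hQ k (-Complex.I) (by simp)
  constructor
  · intro ψ t
    change (qC Q (k+1) ψ : ℝ → ℂ) t = _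
    linear_combination (1/2) * h1 ψ t + (1/2) * h2 ψ t
  · intro ψ t
    change (qS Q (k+1) ψ : ℝ → ℂ) t = _
    have hI := Complex.I_mul_I
    linear_combination (-Complex.I/2) * h1 ψ t + (Complex.I/2) * h2 ψ t +
      ((qS Q (k+1) ψ : ℝ → ℂ) t - Real.sin ((k+1:ℕ) * t) * (ψ : ℝ → ℂ) t) * hI
end
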